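/- The projective Hjelmslev plane PHG(2, ℤ/8ℤ) contains no hyperoval: there is no set of 13 points of PHG(2, ℤ/8ℤ) such that every line contains at most 2 of them. -/

import Mathlib

/-- A point of a projective Hjelmslev geometry PHG(n-1, R): a free rank-1 submodule
of Rⁿ, i.e. the R-span of a vector having at least one unit coordinate. -/
def IsPoint {R : Type} [CommRing R] {n : ℕ} (P : Submodule R (Fin n → R)) : Prop :=
  ∃ v : Fin n → R, (∃ i, IsUnit (v i)) ∧ P = Submodule.span R {v}

/-- A free rank-k submodule of Rⁿ: a submodule linearly isomorphic to Rᵏ. -/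
def IsFreeRank {R : Type} [CommRing R] {n : ℕ} (k : ℕ) (L : Submodule R (Fin n → R)) : Prop :=
  Nonempty ((Fin k → R) ≃ₗ[R] L)

/-- A line of PHG(2, R): a free rank-2 submodule of R³. -/
abbrev IsLine {R : Type} [CommRing R] (L : Submodule R (Fin 3 → R)) : Prop := IsFreeRank 2 L

abbrev R8 := ZMod 8

namespace HypZ8

/-- Coefficients `(n₁, n₂)` of the twelve lines through the point `(1,0,0)`. -/
def nn (k : Fin 12) : R8 × R8 :=
  if k.val < 8 then (1, (k.val : R8)) else (2 * (k.val : R8), 1)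

/-- Direction vector of the `k`-th line. -/
def dd (k : Fin 12) : R8 × R8 :=
  if k.val < 8 then (-(k.val : R8), 1) else (1, -(2 * (k.val : R8)))

/-- A functional taking the value `1` on the direction vector. -/
def mm (k : Fin 12) : R8 × R8 :=
  if k.val < 8 then (0, 1) else (1, 0)

set_option maxRecDepth 100000 in
lemma md : ∀ k, (mm k).1 * (dd k).1 + (mm k).2 * (dd k).2 = 1 := by decide

set_option maxRecDepth 100000 in
lemma nd : ∀ k, (nn k).1 * (dd k).1 + (nn k).2 * (dd k).2 = 0 := by decide

set_option maxRecDepth 100000 in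
set_option maxHeartbeats 4000000 in
lemma ker_eq : ∀ k, ∀ y z : R8, (nn k).1 * y + (nn k).2 * z = 0 →
    y = (dd k).1 * ((mm k).1 * y + (mm k).2 * z) ∧
    z = (dd k).2 * ((mm k).1 * y + (mm k).2 * z) := by decide +kernel

set_option maxRecDepth 100000 in
lemma exists_k : ∀ y z : R8, ∃ k, (nn k).1 * y + (nn k).2 * z = 0 := by decide +kernel

set_option maxRecDepth 100000 in
lemma exists_two : ∀ y z : R8, ∀ k₀ : Fin 12, ∃ k, k ≠ k₀ ∧
    (nn k).1 * (2 * y) + (nn k).2 * (2 * z) = 0 := by decide +kernel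

lemma unit_sq : ∀ u : R8, IsUnit u → u * u = 1 := by
  intro u hu
  obtain ⟨w, hw⟩ := hu.exists_right_inv
  revert u w
  have : ∀ u w : R8, u * w = 1 → u * u = 1 := by decide +kernel
  exact fun u _ w h => this u w h

/-- Coordinate change sending `v` to `(1,0,0)`. -/
def gg (v : Fin 3 → R8) (i : Fin 3) (hu : v i * v i = 1) :
    (Fin 3 → R8) ≃ₗ[R8] (R8 × R8 × R8) where
  toFun x := (v i * x i, x (i + 1) - v (i + 1) * (v i * x i), x (i + 2) - v (i + 2) * (v i * x i))
  map_add' x y := by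
    ext <;> simp <;> ring
  map_smul' c x := by
    ext <;> simp <;> ring
  invFun p j := if j = i then v i * p.1 else if j = i + 1 then p.2.1 + v (i + 1) * p.1
    else p.2.2 + v (i + 2) * p.1
  left_inv x := by
    funext j
    have h1 : v i * (v i * x i) = x i := by rw [← mul_assoc, hu, one_mul]
    fin_cases i <;> fin_cases j <;> simp at h1 ⊢ <;> exact h1
  right_inv p := by
    have h1 : v i * (v i * p.1) = p.1 := by rw [← mul_assoc, hu, one_mul]
    obtain ⟨a, b, c⟩ := p
    fin_cases i <;> simp at h1 ⊢ <;> simp [h1]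

lemma exists_g (v : Fin 3 → R8) (h : ∃ i, IsUnit (v i)) :
    ∃ g : (Fin 3 → R8) ≃ₗ[R8] (R8 × R8 × R8), g v = (1, 0, 0) := by
  obtain ⟨i, hi⟩ := h
  have hu := unit_sq _ hi
  refine ⟨gg v i hu, ?_⟩
  simp [gg, hu]

/-- The `k`-th line through the point with coordinates `(1,0,0)` with respect to `g`. -/
def LL (g : (Fin 3 → R8) ≃ₗ[R8] (R8 × R8 × R8)) (k : Fin 12) : Submodule R8 (Fin 3 → R8) where
  carrier := {x | (nn k).1 * (g x).2.1 + (nn k).2 * (g x).2.2 = 0}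
  zero_mem' := by simp
  add_mem' := by
    intro a b ha hb
    simp only [Set.mem_ofPred_eq, map_add, Prod.snd_add, Prod.fst_add] at *
    linear_combination ha + hb
  smul_mem' := by
    intro c a ha
    simp only [Set.mem_ofPred_eq, map_smul, Prod.smul_snd, Prod.smul_fst, smul_eq_mul] at *
    linear_combination c * ha

lemma mem_LL (g : (Fin 3 → R8) ≃ₗ[R8] (R8 × R8 × R8)) (k : Fin 12) (x) :
    x ∈ LL g k ↔ (nn k).1 * (g x).2.1 + (nn k).2 * (g x).2.2 = 0 := Iff.rfl

lemma isLine_LL (g : (Fin 3 → R8) ≃ₗ[R8] (R8 × R8 × R8)) (k : Fin 12) : IsLine (LL g k) := by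
  refine ⟨{
    toFun := fun p => ⟨g.symm (p 0, (dd k).1 * p 1, (dd k).2 * p 1), ?_⟩
    invFun := fun x => ![(g x).1, (mm k).1 * (g x).2.1 + (mm k).2 * (g x).2.2]
    map_add' := ?_
    map_smul' := ?_
    left_inv := ?_
    right_inv := ?_ }⟩
  · rw [mem_LL]
    simp only [LinearEquiv.apply_symm_apply]
    linear_combination p 1 * nd k
  · intro x y
    apply Subtype.ext
    apply g.injective
    ext <;> simp <;> ring
  · intro c x
    apply Subtype.ext
    apply g.injective
    ext <;> simp <;> ring
  · intro p
    funext j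
    fin_cases j
    · simp
    · simp
      linear_combination p 1 * md k
  · rintro ⟨x, hx⟩
    apply Subtype.ext
    apply g.injective
    have := ker_eq k _ _ ((mem_LL g k x).1 hx)
    refine Prod.ext ?_ (Prod.ext ?_ ?_)
    · simp
    · simpa using this.1.symm
    · simpa using this.2.symm

lemma even_diff : ∀ a b : R8, a.val % 2 = b.val % 2 → ∃ c, b = a + 2 * c := by decide +kernel

/-- Reduction modulo 2. -/
def red (v : Fin 3 → R8) : Fin 3 → Fin 2 := fun i => ⟨(v i).val % 2, Nat.mod_lt _ (by norm_num)⟩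

end HypZ8

open HypZ8

/-- PHG(2, ℤ/8ℤ) contains no hyperoval: no set of 13 = 2³ + 2² + 1 points meets
every line in at most 2 points. -/
theorem no_hyperoval_Z8 :
    ¬ ∃ H : Set (Submodule R8 (Fin 3 → R8)), (∀ P ∈ H, IsPoint P) ∧ H.ncard = 13 ∧
      ∀ L : Submodule R8 (Fin 3 → R8), IsLine L → {P ∈ H | P ≤ L}.ncard ≤ 2 := by
  rintro ⟨H, hP, hc, hL⟩
  classical
  have hfin : H.Finite := Set.finite_of_ncard_ne_zero (by omega)
  obtain ⟨S, rfl⟩ := hfin.exists_finset_coe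
  rw [Set.ncard_coe_finset] at hc
  simp only [Finset.mem_coe] at hP hL
  have hPv : ∀ P : Submodule R8 (Fin 3 → R8), ∃ v : Fin 3 → R8, P ∈ S →
      (∃ i, IsUnit (v i)) ∧ P = Submodule.span R8 {v} := by
    intro P
    by_cases h : P ∈ S
    · obtain ⟨v, hv⟩ := hP P h
      exact ⟨v, fun _ => hv⟩
    · exact ⟨0, fun h' => absurd h' h⟩
  choose v hv using hPv
  -- no three distinct points on a line
  have three : ∀ L, IsLine L → ∀ P ∈ S, ∀ Q ∈ S, ∀ X ∈ S, P ≠ Q → P ≠ X → Q ≠ X →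
      P ≤ L → Q ≤ L → X ≤ L → False := by
    intro L hl P hPS Q hQS X hXS h1 h2 h3 a b c
    have hsub : (({P, Q, X} : Finset (Submodule R8 (Fin 3 → R8))) : Set _) ⊆
        {P | P ∈ S ∧ P ≤ L} := by
      intro Y hY
      simp only [Finset.coe_insert, Finset.coe_singleton, Set.mem_insert_iff,
        Set.mem_singleton_iff] at hY
      rcases hY with rfl | rfl | rfl
      exacts [⟨hPS, a⟩, ⟨hQS, b⟩, ⟨hXS, c⟩]
    have := Set.ncard_le_ncard hsub (S.finite_toSet.subset fun Y hY => hY.1)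
    rw [Set.ncard_coe_finset, Finset.card_eq_three.2 ⟨P, Q, X, h1, h2, h3, rfl⟩] at this
    have := hL L hl
    omega
  -- two neighbouring points
  obtain ⟨P, hPS, Q, hQS, hPQ, hred⟩ : ∃ P ∈ S, ∃ Q ∈ S, P ≠ Q ∧ red (v P) = red (v Q) := by
    apply Finset.exists_ne_map_eq_of_card_lt_of_maps_to (t := Finset.univ)
    · rw [hc]; decide
    · intro _ _; simp
  obtain ⟨hPu, hPs⟩ := hv P hPS
  obtain ⟨g, hg⟩ := exists_g _ hPu
  have le_iff : ∀ X ∈ S, ∀ k, X ≤ LL g k ↔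
      (nn k).1 * (g (v X)).2.1 + (nn k).2 * (g (v X)).2.2 = 0 := by
    intro X hX k
    conv_lhs => rw [(hv X hX).2]
    rw [Submodule.span_singleton_le_iff_mem, mem_LL]
  have hPL : ∀ k, P ≤ LL g k := by
    intro k
    rw [le_iff P hPS, hg]
    simp
  have hk : ∀ X, ∃ k, X ∈ S → X ≤ LL g k := by
    intro X
    obtain ⟨k, hk⟩ := exists_k (g (v X)).2.1 (g (v X)).2.2
    exact ⟨k, fun h => (le_iff X h k).2 hk⟩
  choose κ hκ using hk
  have hinj : Set.InjOn κ (S.erase P : Finset _) := by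
    intro X hX Y hY hXY
    simp only [Finset.coe_erase, Set.mem_sdiff, Finset.mem_coe, Set.mem_singleton_iff] at hX hY
    by_contra hne
    exact three _ (isLine_LL g (κ X)) P hPS X hX.1 Y hY.1 (Ne.symm hX.2) (Ne.symm hY.2) hne
      (hPL _) (hκ X hX.1) (hXY ▸ hκ Y hY.1)
  have himg : (S.erase P).image κ = Finset.univ := by
    apply Finset.eq_univ_of_card
    rw [Finset.card_image_of_injOn hinj, Finset.card_erase_of_mem hPS, hc]
    simp
  have hw : ∀ i, ∃ c, v Q i = v P i + 2 * c := by
    intro i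
    apply even_diff
    have := congrFun hred i
    simpa [red] using this
  choose w hw using hw
  have hgQ : g (v Q) = (1, 0, 0) + (2 : R8) • g w := by
    rw [← hg, ← map_smul, ← map_add]
    congr 1
    funext i
    simp [hw i]
  obtain ⟨k, hkne, hk⟩ := exists_two (g w).2.1 (g w).2.2 (κ Q)
  have hQk : Q ≤ LL g k := by
    rw [le_iff Q hQS, hgQ]
    simpa using hk
  obtain ⟨X, hX, hXk⟩ := Finset.mem_image.1 (himg ▸ Finset.mem_univ k)
  rw [Finset.mem_erase] at hX
  refine three _ (isLine_LL g k) P hPS Q hQS X hX.2 hPQ (Ne.symm hX.1) ?_ (hPL _) hQk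
    (hXk ▸ hκ X hX.2)
  rintro rfl
  exact hkne hXk.symm
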